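/- Let d ≤ ℓ < 2d, let m ≥ 0 be an integer with m+1 ≠ 0 in K, and let v ∈ ℤ^{n+1} have degree dm + ℓ. Then the K-linear map π : ℰ_{v,ℓ} → K[x^±]_{B(v,ℓ)} × K[x^±]_{D(v,ℓ−d)} given by G ↦ (G|_{B(v,ℓ)}, (FG)|_{D(v,ℓ−d)}) is injective; consequently dim_K ℰ_{v,ℓ} ≤ b_ℓ + b_{ℓ−d}, and if in addition F is nondegenerate, then dim_K ℰ_{v,ℓ} ≤ d^n. -/

import Mathlib

noncomputable section

open MvPolynomial

/-- The finset `D_ℓ` of exponent vectors in `ℤ_{≥0}^{n+1}` of total degree `ℓ`,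
realized as integer vectors. -/
def Dfin (n ℓ : ℕ) : Finset (Fin (n + 1) → ℤ) :=
  (Finset.Nat.antidiagonalTuple (n + 1) ℓ).image fun t i => (t i : ℤ)

/-- The inverted simplex `D(v,ℓ) = {v - w : w ∈ D_ℓ}`. -/
def Dv {n : ℕ} (v : Fin (n + 1) → ℤ) (ℓ : ℕ) : Finset (Fin (n + 1) → ℤ) :=
  (Dfin n ℓ).image fun w => v - w

/-- The coefficient of a polynomial at an integer exponent vector (zero if some exponent
is negative). -/
def coeffZ {K : Type*} [Field K] {n : ℕ} (F : MvPolynomial (Fin (n + 1)) K)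
    (u : Fin (n + 1) → ℤ) : K :=
  if ∀ i, 0 ≤ u i then
    MvPolynomial.coeff (Finsupp.equivFunOnFinite.symm fun i => (u i).toNat) F
  else 0

/-- The linear functional
`G ↦ Σ_{t ∈ D_d} ((v_i - s_i) - (m+1)·t_i) · F_t · G_{v-s-t}`, i.e. the difference of the
two sides of the defining equation of `ℰ_{v,ℓ}` at `(s,i)`. -/
def eqFun {K : Type*} [Field K] {n : ℕ} (F : MvPolynomial (Fin (n + 1)) K) (d m : ℕ)
    (v s : Fin (n + 1) → ℤ) (i : Fin (n + 1)) : ((Fin (n + 1) → ℤ) →₀ K) →ₗ[K] K :=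
  ∑ t ∈ Dfin n d,
    ((((v i - s i : ℤ) : K) - ((m : K) + 1) * ((t i : ℤ) : K)) * coeffZ F t) •
      (Finsupp.lapply (v - s - t) : ((Fin (n + 1) → ℤ) →₀ K) →ₗ[K] K)

/-- The space `ℰ_{v,ℓ}`: Laurent polynomials `G` supported on `D(v,ℓ)` such that for every
`s ∈ D_{ℓ-d}` and every `i ∈ {0,…,n}`,
`(v_i - s_i) Σ_{t∈D_d} F_t G_{v-s-t} = (m+1) Σ_{t∈D_d} t_i F_t G_{v-s-t}`. -/
def Espace {K : Type*} [Field K] {n : ℕ} (F : MvPolynomial (Fin (n + 1)) K) (d m : ℕ)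
    (v : Fin (n + 1) → ℤ) (ℓ : ℕ) : Submodule K ((Fin (n + 1) → ℤ) →₀ K) :=
  Finsupp.supported K K ↑(Dv v ℓ) ⊓
    ⨅ s ∈ Dfin n (ℓ - d), ⨅ i : Fin (n + 1), LinearMap.ker (eqFun F d m v s i)

/-- Restriction `G|_S` of a Laurent polynomial to a finite set of monomials. -/
def restrictF {K : Type*} [Field K] {n : ℕ} (G : (Fin (n + 1) → ℤ) →₀ K)
    (S : Finset (Fin (n + 1) → ℤ)) : (Fin (n + 1) → ℤ) →₀ K :=
  ∑ u ∈ S, Finsupp.single u (G u)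

/-- Restriction `F|_S` of a polynomial to a finite set of (integer) monomials, as a Laurent
polynomial. -/
def restrictPoly {K : Type*} [Field K] {n : ℕ} (F : MvPolynomial (Fin (n + 1)) K)
    (S : Finset (Fin (n + 1) → ℤ)) : (Fin (n + 1) → ℤ) →₀ K :=
  ∑ u ∈ S, Finsupp.single u (coeffZ F u)

/-- The coefficient of the product `F·G` at the integer exponent vector `w`, where `F` is a
polynomial and `G` a Laurent polynomial. -/
def mulCoeffZ {K : Type*} [Field K] {n : ℕ} (F : MvPolynomial (Fin (n + 1)) K)
    (G : (Fin (n + 1) → ℤ) →₀ K) (w : Fin (n + 1) → ℤ) : K :=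
  ∑ t ∈ F.support, MvPolynomial.coeff t F * G fun i => w i - (t i : ℤ)

/-- The ideal `I_F = ⟨∂_0F, …, ∂_nF⟩` where `∂_i = x_i ∂/∂x_i`. -/
def partialIdeal {K : Type*} [Field K] {n : ℕ} (F : MvPolynomial (Fin (n + 1)) K) :
    Ideal (MvPolynomial (Fin (n + 1)) K) :=
  Ideal.span (Set.range fun i => X i * pderiv i F)

/-- `b_ℓ := dim_K K[x]_ℓ / (I_F)_ℓ`, the dimension of the degree-`ℓ` graded piece of
`K[x]/I_F`. -/
def bdim {K : Type*} [Field K] {n : ℕ} (F : MvPolynomial (Fin (n + 1)) K) (ℓ : ℕ) : ℕ :=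
  Module.finrank K
    (Submodule.map (Ideal.Quotient.mkₐ K (partialIdeal F)).toLinearMap
      (homogeneousSubmodule (Fin (n + 1)) K ℓ))

/-- The monomials `x^β`, `β ∈ B`, project to a `K`-basis of the degree-`ℓ` graded piece of
`K[x]/I_F`. -/
def IsMonomialBasis {K : Type*} [Field K] {n : ℕ} (F : MvPolynomial (Fin (n + 1)) K)
    (ℓ : ℕ) (B : Finset (Fin (n + 1) → ℕ)) : Prop :=
  LinearIndependent K (fun β : ↥B =>
      Ideal.Quotient.mk (partialIdeal F)
        (MvPolynomial.monomial
          (Finsupp.equivFunOnFinite.symm (β : Fin (n + 1) → ℕ)) (1 : K)))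
  ∧ Submodule.span K (Set.range fun β : ↥B =>
      Ideal.Quotient.mk (partialIdeal F)
        (MvPolynomial.monomial
          (Finsupp.equivFunOnFinite.symm (β : Fin (n + 1) → ℕ)) (1 : K)))
    = Submodule.map (Ideal.Quotient.mkₐ K (partialIdeal F)).toLinearMap
        (homogeneousSubmodule (Fin (n + 1)) K ℓ)

section Koszul

variable {A : Type*} [CommRing A] {r : ℕ}

/-- The sign of moving `i` past the elements of `S` that are smaller than `i`. -/
def koszulSign (A : Type*) [CommRing A] {r : ℕ} (i : Fin r) (S : Finset (Fin r)) : A :=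
  (-1) ^ (S.filter (· < i)).card

lemma koszulSign_mul_self (i : Fin r) (S : Finset (Fin r)) :
    koszulSign A i S * koszulSign A i S = 1 := by
  rw [koszulSign, ← mul_pow]; simp

lemma koszulSign_insert_self (i : Fin r) (S : Finset (Fin r)) :
    koszulSign A i (insert i S) = koszulSign A i S := by
  simp [koszulSign, Finset.filter_insert]

lemma koszulSign_insert {i j : Fin r} {S : Finset (Fin r)} (hj : j ∉ S) :
    koszulSign A i (insert j S) = (if j < i then -1 else 1) * koszulSign A i S := by
  rw [koszulSign, koszulSign, Finset.filter_insert]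
  split_ifs
  · rw [Finset.card_insert_of_notMem (by simp [hj]), pow_succ']
  · simp

lemma koszulSign_erase {i j : Fin r} {S : Finset (Fin r)} (hj : j ∈ S) :
    koszulSign A i (S.erase j) = (if j < i then -1 else 1) * koszulSign A i S := by
  conv_rhs => rw [← Finset.insert_erase hj, koszulSign_insert (Finset.notMem_erase j S)]
  split_ifs <;> simp

/-- Contraction with the `i`-th coordinate on the exterior algebra of `A ^ r`, whose elements are
written in the basis of wedge products indexed by finite subsets of `Fin r`. -/
def koszulContract (A : Type*) [CommRing A] {r : ℕ} (i : Fin r) :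
    (Finset (Fin r) → A) →ₗ[A] (Finset (Fin r) → A) where
  toFun x S := if i ∈ S then 0 else koszulSign A i S * x (insert i S)
  map_add' x y := by ext S; by_cases h : i ∈ S <;> simp [h, mul_add]
  map_smul' a x := by ext S; by_cases h : i ∈ S <;> simp [h, mul_left_comm]

/-- Left exterior multiplication by the `i`-th basis vector. -/
def koszulWedge (A : Type*) [CommRing A] {r : ℕ} (i : Fin r) :
    (Finset (Fin r) → A) →ₗ[A] (Finset (Fin r) → A) where
  toFun x S := if i ∈ S then koszulSign A i S * x (S.erase i) else 0
  map_add' x y := by ext S; by_cases h : i ∈ S <;> simp [h, mul_add]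
  map_smul' a x := by ext S; by_cases h : i ∈ S <;> simp [h, mul_left_comm]

lemma koszulContract_apply (i : Fin r) (x : Finset (Fin r) → A) (S : Finset (Fin r)) :
    koszulContract A i x S = if i ∈ S then 0 else koszulSign A i S * x (insert i S) := rfl

lemma koszulWedge_apply (i : Fin r) (x : Finset (Fin r) → A) (S : Finset (Fin r)) :
    koszulWedge A i x S = if i ∈ S then koszulSign A i S * x (S.erase i) else 0 := rfl

lemma koszulContract_self (i : Fin r) (x : Finset (Fin r) → A) :
    koszulContract A i (koszulContract A i x) = 0 := by
  ext S
  simp [koszulContract_apply]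

lemma koszulContract_anticomm {i j : Fin r} (hij : i ≠ j) (x : Finset (Fin r) → A) :
    koszulContract A i (koszulContract A j x) + koszulContract A j (koszulContract A i x) = 0 := by
  ext S
  by_cases hi : i ∈ S <;> by_cases hj : j ∈ S <;>
    simp only [koszulContract_apply, Pi.add_apply, Pi.zero_apply, Finset.mem_insert, hi, hj, hij,
      hij.symm, or_true, or_false, if_true, if_false, mul_zero, add_zero,
      Finset.insert_comm j i]
  rw [koszulSign_insert hi, koszulSign_insert hj]
  rcases lt_or_gt_of_ne hij with h | h <;> simp [h, h.not_gt] <;> ring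

lemma koszulContract_wedge_self (i : Fin r) (x : Finset (Fin r) → A) :
    koszulContract A i (koszulWedge A i x) + koszulWedge A i (koszulContract A i x) = x := by
  ext S
  by_cases hi : i ∈ S
  · simp [koszulContract_apply, koszulWedge_apply, hi, koszulSign_erase hi, ← mul_assoc,
      koszulSign_mul_self]
  · simp [koszulContract_apply, koszulWedge_apply, hi, koszulSign_insert_self, ← mul_assoc,
      koszulSign_mul_self]

lemma koszulContract_wedge_of_ne {i j : Fin r} (hij : i ≠ j) (x : Finset (Fin r) → A) :
    koszulContract A i (koszulWedge A j x) + koszulWedge A j (koszulContract A i x) = 0 := by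
  ext S
  by_cases hi : i ∈ S <;> by_cases hj : j ∈ S <;>
    simp only [koszulContract_apply, koszulWedge_apply, Pi.add_apply, Pi.zero_apply,
      Finset.mem_insert, Finset.mem_erase, hi, hj, hij, hij.symm, or_true, or_false,
      and_true, and_false, ne_eq, not_false_eq_true, if_true, if_false, mul_zero, add_zero]
  rw [koszulSign_insert hi, koszulSign_erase hj, Finset.erase_insert_of_ne hij]
  rcases lt_or_gt_of_ne hij with h | h <;> simp [h, h.not_gt] <;> ring

/-- The Koszul differential attached to a family `f` of `r` ring elements. -/
def koszulD (f : Fin r → A) : (Finset (Fin r) → A) →ₗ[A] (Finset (Fin r) → A) :=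
  ∑ i, f i • koszulContract A i

lemma koszulD_apply (f : Fin r → A) (x : Finset (Fin r) → A) :
    koszulD f x = ∑ i, f i • koszulContract A i x := by
  simp [koszulD]

lemma koszulD_koszulD (f : Fin r → A) (x : Finset (Fin r) → A) :
    koszulD f (koszulD f x) = 0 := by
  simp only [koszulD_apply, map_sum, map_smul, Finset.smul_sum, smul_smul]
  rw [← Finset.sum_product']
  refine Finset.sum_involution (fun p _ => p.swap) ?_ ?_ (by simp) (by simp)
  · rintro ⟨i, j⟩ -
    rcases eq_or_ne i j with rfl | hij
    · simp [koszulContract_self]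
    · simp only [Prod.fst_swap, Prod.snd_swap]
      rw [mul_comm (f j), ← smul_add, koszulContract_anticomm hij.symm, smul_zero]
  · rintro ⟨i, j⟩ - hne heq
    obtain rfl : j = i := congrArg Prod.fst heq
    simp [koszulContract_self] at hne

lemma koszulD_wedge (f : Fin r → A) (j : Fin r) (x : Finset (Fin r) → A) :
    koszulD f (koszulWedge A j x) + koszulWedge A j (koszulD f x) = f j • x := by
  simp only [koszulD_apply, map_sum, map_smul, ← Finset.sum_add_distrib, ← smul_add]
  rw [Finset.sum_eq_single j _ (by simp), koszulContract_wedge_self]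
  intro i _ hij
  rw [koszulContract_wedge_of_ne hij, smul_zero]

lemma koszulD_apply_mem_span (f : Fin r → A) (x : Finset (Fin r) → A) (S : Finset (Fin r)) :
    koszulD f x S ∈ Ideal.span (Set.range f) := by
  rw [koszulD_apply, Finset.sum_apply]
  exact Ideal.sum_mem _ fun i _ =>
    Ideal.mul_mem_right _ _ (Ideal.subset_span (Set.mem_range_self i))

lemma koszulD_apply_mem (f : Fin r → A) {J : Ideal A} {x : Finset (Fin r) → A}
    (hx : ∀ S, x S ∈ J) (S : Finset (Fin r)) : koszulD f x S ∈ J := by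
  rw [koszulD_apply, Finset.sum_apply]
  refine Ideal.sum_mem _ fun i _ => J.mul_mem_left _ ?_
  rw [koszulContract_apply]
  split_ifs
  exacts [J.zero_mem, J.mul_mem_left _ (hx _)]

/-- If `g` is a sequence of `r` elements of `(f)`, regular in the weak sense, then the Koszul
homology of `f` modulo the first `k` elements of `g` vanishes above degree `k`. -/
lemma koszul_exact_mod (f : Fin r → A) (g : ℕ → A)
    (hg : ∀ k < r, g k ∈ Ideal.span (Set.range f))
    (hreg : ∀ k < r, ∀ p, g k * p ∈ Ideal.span (g '' Set.Iio k) → p ∈ Ideal.span (g '' Set.Iio k))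
    {k : ℕ} (hk : k ≤ r) (x : Finset (Fin r) → A) (hx : ∀ S, S.card ≤ k → x S = 0)
    (hdx : ∀ S, koszulD f x S ∈ Ideal.span (g '' Set.Iio k)) :
    ∃ y, ∀ S, x S - koszulD f y S ∈ Ideal.span (g '' Set.Iio k) := by
  induction hk using Nat.decreasingInduction generalizing x with
  | self =>
    refine ⟨0, fun S => ?_⟩
    simp [hx S (by simpa using S.card_le_univ)]
  | of_succ k hk ih =>
    set J := Ideal.span (g '' Set.Iio k) with hJ
    have hJ' : Ideal.span (g '' Set.Iio (k + 1)) = Ideal.span {g k} ⊔ J := by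
      rw [hJ, ← Ideal.span_union, ← Set.image_singleton, ← Set.image_union]
      congr 2; ext; simp
    obtain ⟨ω, hω⟩ := (Ideal.mem_span_range_iff_exists_fun).1 (hg k hk)
    let W : (Finset (Fin r) → A) →ₗ[A] (Finset (Fin r) → A) := ∑ j, ω j • koszulWedge A j
    have hW (z : Finset (Fin r) → A) : W z = ∑ j, ω j • koszulWedge A j z := by simp [W]
    have hWhom (z : Finset (Fin r) → A) : koszulD f (W z) + W (koszulD f z) = g k • z := by
      rw [hW, hW, map_sum, ← Finset.sum_add_distrib, ← hω, Finset.sum_smul]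
      refine Finset.sum_congr rfl fun j _ => ?_
      rw [map_smul, ← smul_add, koszulD_wedge, smul_smul]
    have hWmem (z : Finset (Fin r) → A) (hz : ∀ S, z S ∈ J) (S) : W z S ∈ J := by
      rw [hW, Finset.sum_apply]
      refine Ideal.sum_mem _ fun i _ => J.mul_mem_left _ ?_
      rw [koszulWedge_apply]
      split_ifs
      exacts [J.mul_mem_left _ (hz _), J.zero_mem]
    have hkey (S) : g k * x S - koszulD f (W x) S ∈ J := by
      have : g k * x S - koszulD f (W x) S = W (koszulD f x) S := by
        have := congrFun (hWhom x) S
        simp only [Pi.add_apply, Pi.smul_apply, smul_eq_mul] at this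
        rw [← this]; ring
      rw [this]
      exact hWmem _ hdx S
    obtain ⟨y, hy⟩ := ih (W x)
      (by
        intro S hS
        rw [hW, Finset.sum_apply]
        refine Finset.sum_eq_zero fun j _ => ?_
        rw [Pi.smul_apply, koszulWedge_apply]
        split_ifs with hj
        · rw [hx _ (by rw [Finset.card_erase_of_mem hj]; omega)]; simp
        · simp)
      (by
        intro S
        rw [hJ']
        have h1 : g k * x S ∈ Ideal.span {g k} ⊔ J :=
          Ideal.mem_sup_left (Ideal.mul_mem_right _ _ (Ideal.mem_span_singleton_self _))
        have := Ideal.sub_mem _ h1 (Ideal.mem_sup_right (hkey S))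
        simpa using this)
    have hu (S) : ∃ u, W x S - koszulD f y S - g k * u ∈ J := by
      have := hy S
      rw [hJ', Submodule.mem_sup] at this
      obtain ⟨a, ha, b, hb, hab⟩ := this
      obtain ⟨u, rfl⟩ := Ideal.mem_span_singleton'.1 ha
      exact ⟨u, by rw [← hab, mul_comm]; simpa using hb⟩
    choose u hu using hu
    refine ⟨u, fun S => hreg k hk _ ?_⟩
    have h2 : koszulD f (W x - koszulD f y - g k • u) S ∈ J := koszulD_apply_mem f hu S
    rw [map_sub, map_sub, koszulD_koszulD, map_smul, sub_zero] at h2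
    have := J.add_mem (hkey S) h2
    simpa [mul_sub] using this

/-- If `(f)` contains a weakly regular sequence of length `r`, then every syzygy of the `r`
elements `f` has its coefficients in `(f)`. -/
lemma syzygy_mem_span (f : Fin r → A) (g : ℕ → A)
    (hg : ∀ k < r, g k ∈ Ideal.span (Set.range f))
    (hreg : ∀ k < r, ∀ p, g k * p ∈ Ideal.span (g '' Set.Iio k) → p ∈ Ideal.span (g '' Set.Iio k))
    (a : Fin r → A) (ha : ∑ i, a i * f i = 0) (i : Fin r) :
    a i ∈ Ideal.span (Set.range f) := by
  let x : Finset (Fin r) → A := fun S => ∑ j, if S = {j} then a j else 0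
  have hx0 (S : Finset (Fin r)) (hS : S.card ≠ 1) : x S = 0 :=
    Finset.sum_eq_zero fun j _ => if_neg (by rintro rfl; simp at hS)
  have hx1 (j : Fin r) : x {j} = a j := by simp [x]
  obtain ⟨y, hy⟩ := koszul_exact_mod f g hg hreg (Nat.zero_le r) x
    (fun S hS => hx0 S (by omega))
    (fun S => by
      rw [koszulD_apply, Finset.sum_apply]
      suffices h : ∑ j, (f j • koszulContract A j x) S = 0 by rw [h]; exact Ideal.zero_mem _
      rcases S.eq_empty_or_nonempty with rfl | hS
      · rw [← ha]
        refine Finset.sum_congr rfl fun j _ => ?_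
        simp [koszulContract_apply, koszulSign, hx1, mul_comm]
      · refine Finset.sum_eq_zero fun j _ => ?_
        rw [Pi.smul_apply, koszulContract_apply]
        split_ifs with hj
        · simp
        · rw [hx0 _ (by rw [Finset.card_insert_of_notMem hj]; have := hS.card_pos; omega)]
          simp)
  have h := hy {i}
  have hbot : Ideal.span (g '' Set.Iio 0) = ⊥ := by simp
  rw [hbot, Ideal.mem_bot, sub_eq_zero, hx1] at h
  rw [h]
  exact koszulD_apply_mem_span f y _

end Koszul

section Polynomial

variable {K : Type*} [Field K] {n : ℕ}

lemma mem_span_X_pow_of_X_pow_mul_mem {σ R : Type*} [CommRing R] (N : ℕ) {s : Set σ} {i : σ}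
    (hi : i ∉ s) {p : MvPolynomial σ R}
    (hp : X i ^ N * p ∈ Ideal.span ((fun j => (X j : MvPolynomial σ R) ^ N) '' s)) :
    p ∈ Ideal.span ((fun j => (X j : MvPolynomial σ R) ^ N) '' s) := by
  classical
  have himage : (fun j => (X j : MvPolynomial σ R) ^ N) '' s =
      (fun t => monomial t (1 : R)) '' ((fun j => Finsupp.single j N) '' s) := by
    simp [Set.image_image, X_pow_eq_monomial]
  rw [himage, mem_ideal_span_monomial_image] at hp ⊢
  intro t ht
  obtain ⟨_, ⟨j, hj, rfl⟩, hle⟩ := hp (Finsupp.single i N + t) (by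
    rw [mem_support_iff, X_pow_eq_monomial, coeff_monomial_mul, one_mul]
    exact mem_support_iff.1 ht)
  refine ⟨_, ⟨j, hj, rfl⟩, ?_⟩
  have hij : i ≠ j := fun h => hi (h ▸ hj)
  rw [Finsupp.single_le_iff] at hle ⊢
  simpa [Finsupp.single_apply, hij] using hle

lemma X_pow_mem_span_of_nondegenerate {σ ι : Type*} [Finite σ]
    (f : ι → MvPolynomial σ K)
    (hf : ∀ x : σ → AlgebraicClosure K, (∀ i, aeval x (f i) = 0) → x = 0) :
    ∃ N : ℕ, ∀ i, (X i : MvPolynomial σ K) ^ N ∈ Ideal.span (Set.range f) := by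
  have := Fintype.ofFinite σ
  have h (i : σ) : ∃ N : ℕ, (X i : MvPolynomial σ K) ^ N ∈ Ideal.span (Set.range f) := by
    change X i ∈ (Ideal.span (Set.range f)).radical
    rw [← vanishingIdeal_zeroLocus_eq_radical (K := AlgebraicClosure K), zeroLocus_span]
    intro x hx
    simp [hf x fun i => hx _ (Set.mem_range_self i)]
  choose N hN using h
  exact ⟨∑ i, N i, fun i => Ideal.pow_mem_of_pow_mem _ (hN i)
    (Finset.single_le_sum (f := N) (fun _ _ => Nat.zero_le _) (Finset.mem_univ i))⟩

/-- Forms `f_0, …, f_n` in `n + 1` variables with no common projective zero have only the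
syzygies with coefficients in `(f)`. -/
lemma syzygy_mem_span_of_nondegenerate {r : ℕ} (f : Fin r → MvPolynomial (Fin r) K)
    (hf : ∀ x : Fin r → AlgebraicClosure K, (∀ i, aeval x (f i) = 0) → x = 0)
    (a : Fin r → MvPolynomial (Fin r) K) (ha : ∑ i, a i * f i = 0) (i : Fin r) :
    a i ∈ Ideal.span (Set.range f) := by
  obtain ⟨N, hN⟩ := X_pow_mem_span_of_nondegenerate f hf
  refine syzygy_mem_span f (fun k => if h : k < r then X ⟨k, h⟩ ^ N else 0)
    (fun k hk => by simpa [hk] using hN ⟨k, hk⟩) (fun k hk p hp => ?_) a ha i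
  have himage : (fun k => if h : k < r then (X ⟨k, h⟩ : MvPolynomial (Fin r) K) ^ N else 0) ''
      Set.Iio k = (fun j => X j ^ N) '' Set.Iio (⟨k, hk⟩ : Fin r) := by
    ext q
    constructor
    · rintro ⟨j, hj, rfl⟩
      exact ⟨⟨j, lt_trans hj hk⟩, hj, by simp [lt_trans hj hk]⟩
    · rintro ⟨j, hj, rfl⟩
      exact ⟨j, hj, by simp⟩
  rw [himage] at hp ⊢
  simp only [hk, dite_true] at hp
  exact mem_span_X_pow_of_X_pow_mul_mem N (by simp) hp

lemma isHomogeneous_X_mul_pderiv {F : MvPolynomial (Fin (n + 1)) K} {d : ℕ}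
    (hd : d ≠ 0) (hF : F.IsHomogeneous d) (i : Fin (n + 1)) :
    (X i * pderiv i F).IsHomogeneous d := by
  have := (isHomogeneous_X K i).mul (hF.pderiv (i := i))
  rwa [show 1 + (d - 1) = d by omega] at this

lemma eq_zero_of_mem_partialIdeal {F : MvPolynomial (Fin (n + 1)) K} {d e : ℕ}
    (hF : F.IsHomogeneous d) (he : e < d) {p : MvPolynomial (Fin (n + 1)) K}
    (hp : p.IsHomogeneous e) (hpI : p ∈ partialIdeal F) : p = 0 := by
  have hle : partialIdeal F ≤ idealOfVars (Fin (n + 1)) K ^ d := by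
    rw [partialIdeal, Ideal.span_le]
    rintro _ ⟨i, rfl⟩
    rw [SetLike.mem_coe, mem_pow_idealOfVars_iff']
    intro t ht
    by_contra hne
    have h := isHomogeneous_X_mul_pderiv (by omega) hF i
    exact ht.ne (by rw [Finsupp.degree_eq_weight_one]; exact h hne)
  have h := (mem_pow_idealOfVars_iff' d p).1 (hle hpI)
  ext t
  rw [coeff_zero]
  by_contra hne
  have : t.degree = e := by rw [Finsupp.degree_eq_weight_one]; exact hp hne
  exact hne (h t (this ▸ he))

lemma degree_eq_iff_mem_antidiagonalTuple {r : ℕ} (t : Fin r →₀ ℕ) (e : ℕ) :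
    t.degree = e ↔ ⇑t ∈ Finset.Nat.antidiagonalTuple r e := by
  rw [Finset.Nat.mem_antidiagonalTuple, Finsupp.degree_eq_sum]

lemma finrank_homogeneousSubmodule (r e : ℕ) :
    Module.finrank K (homogeneousSubmodule (Fin r) K e) =
      (Finset.Nat.antidiagonalTuple r e).card := by
  rw [homogeneousSubmodule_eq_finsupp_supported]
  have b := basisRestrictSupport K {t : Fin r →₀ ℕ | t.degree = e}
  have h := Module.finrank_eq_nat_card_basis b
  rw [restrictSupport] at h
  rw [h, ← Fintype.card_coe, ← Nat.card_eq_fintype_card]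
  exact Nat.card_congr (Finsupp.equivFunOnFinite.subtypeEquiv fun t =>
    degree_eq_iff_mem_antidiagonalTuple t e)

instance (r e : ℕ) : FiniteDimensional K (homogeneousSubmodule (Fin r) K e) :=
  Module.Finite.iff_fg.2 (homogeneousSubmodule_fg (Fin r) K e)

lemma bdim_eq_finrank_range (F : MvPolynomial (Fin (n + 1)) K) (e : ℕ) :
    bdim F e = Module.finrank K (LinearMap.range
      ((Ideal.Quotient.mkₐ K (partialIdeal F)).toLinearMap.domRestrict
        (homogeneousSubmodule (Fin (n + 1)) K e))) := by
  rw [bdim, LinearMap.range_domRestrict]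

lemma bdim_of_lt {F : MvPolynomial (Fin (n + 1)) K} {d e : ℕ} (hF : F.IsHomogeneous d)
    (he : e < d) : bdim F e = (Finset.Nat.antidiagonalTuple (n + 1) e).card := by
  rw [bdim_eq_finrank_range, ← finrank_homogeneousSubmodule (K := K)]
  refine LinearMap.finrank_range_of_inj ?_
  rw [← LinearMap.ker_eq_bot, LinearMap.ker_eq_bot']
  intro p hp
  exact Subtype.ext (eq_zero_of_mem_partialIdeal hF he p.2 (Ideal.Quotient.eq_zero_iff_mem.1 hp))

/-- The form `∑ aᵢ xᵢ ∂F/∂xᵢ` of degree `e + d` attached to forms `aᵢ` of degree `e`. -/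
def syzygyMap (F : MvPolynomial (Fin (n + 1)) K) (e : ℕ) :
    (Fin (n + 1) → homogeneousSubmodule (Fin (n + 1)) K e) →ₗ[K] MvPolynomial (Fin (n + 1)) K :=
  ∑ i, (LinearMap.mulRight K (X i * pderiv i F)) ∘ₗ (Submodule.subtype _) ∘ₗ LinearMap.proj i

lemma syzygyMap_apply (F : MvPolynomial (Fin (n + 1)) K) (e : ℕ)
    (a : Fin (n + 1) → homogeneousSubmodule (Fin (n + 1)) K e) :
    syzygyMap F e a = ∑ i, (a i : MvPolynomial (Fin (n + 1)) K) * (X i * pderiv i F) := by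
  simp [syzygyMap, mul_assoc]

lemma bdim_add_le {F : MvPolynomial (Fin (n + 1)) K} {d e : ℕ} (hF : F.IsHomogeneous d)
    (he : e < d)
    (hnd : ∀ x : Fin (n + 1) → AlgebraicClosure K,
      (∀ i, aeval x (X i * pderiv i F) = 0) → x = 0) :
    bdim F (e + d) + (n + 1) * (Finset.Nat.antidiagonalTuple (n + 1) e).card ≤
      (Finset.Nat.antidiagonalTuple (n + 1) (e + d)).card := by
  let H := homogeneousSubmodule (Fin (n + 1)) K (e + d)
  let q := (Ideal.Quotient.mkₐ K (partialIdeal F)).toLinearMap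
  have hinj : Function.Injective (syzygyMap F e) := by
    rw [← LinearMap.ker_eq_bot, LinearMap.ker_eq_bot']
    intro a ha
    rw [syzygyMap_apply] at ha
    ext1 i
    exact Subtype.ext (eq_zero_of_mem_partialIdeal hF he (a i).2
      (syzygy_mem_span_of_nondegenerate _ hnd (fun i => (a i).1) ha i))
  have hle : LinearMap.range (syzygyMap F e) ≤ H ⊓ LinearMap.ker q := by
    rintro _ ⟨a, rfl⟩
    rw [syzygyMap_apply]
    refine ⟨Submodule.sum_mem _ fun i _ =>
      (a i).2.mul (isHomogeneous_X_mul_pderiv (by omega) hF i), ?_⟩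
    rw [SetLike.mem_coe, LinearMap.mem_ker]
    exact Ideal.Quotient.eq_zero_iff_mem.2 (Ideal.sum_mem _ fun i _ =>
      Ideal.mul_mem_left _ _ (Ideal.subset_span (Set.mem_range_self i)))
  have h1 := LinearMap.finrank_range_of_inj hinj
  rw [Module.finrank_pi_fintype] at h1
  simp only [finrank_homogeneousSubmodule, Finset.sum_const, Finset.card_univ, Fintype.card_fin,
    smul_eq_mul] at h1
  have h2 := (q.domRestrict H).finrank_range_add_finrank_ker
  rw [finrank_homogeneousSubmodule, ← bdim_eq_finrank_range] at h2
  have h3 : Module.finrank K (LinearMap.ker (q.domRestrict H)) =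
      Module.finrank K ↥(H ⊓ LinearMap.ker q) := by
    rw [LinearMap.ker_domRestrict, ← Submodule.map_comap_subtype, Submodule.finrank_map_subtype_eq]
  have : FiniteDimensional K ↥(H ⊓ LinearMap.ker q) := Submodule.finiteDimensional_inf_left _ _
  have h4 := Submodule.finrank_mono hle
  omega

end Polynomial

section Counting

lemma card_filter_sum_mod_le (n d e : ℕ) :
    ((Fintype.piFinset fun _ : Fin (n + 1) => Finset.range d).filter
      fun t => (∑ i, t i) % d = e).card ≤ d ^ n := by
  have hcard : (Fintype.piFinset fun _ : Fin n => Finset.range d).card = d ^ n := by simp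
  rw [← hcard]
  refine Finset.card_le_card_of_injOn Fin.tail ?_ ?_
  · intro t ht
    simp only [Finset.coe_filter, Fintype.mem_piFinset, Finset.mem_range, Set.mem_ofPred_eq] at ht
    simpa [Fin.tail] using fun i : Fin n => ht.1 i.succ
  · intro t ht t' ht' htt'
    simp only [Finset.coe_filter, Fintype.mem_piFinset, Finset.mem_range, Set.mem_ofPred_eq,
      Fin.sum_univ_succ] at ht ht'
    have htail (i : Fin n) : t i.succ = t' i.succ := congrFun htt' i
    have h0 : t 0 = t' 0 := by
      have h : t 0 + ∑ i : Fin n, t' i.succ ≡ t' 0 + ∑ i : Fin n, t' i.succ [MOD d] := by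
        rw [Nat.ModEq, ht'.2, ← ht.2]
        simp only [htail]
      exact (Nat.ModEq.add_right_cancel' _ h).eq_of_lt_of_lt (ht.1 0) (ht'.1 0)
    ext i
    exact Fin.cases h0 htail i

lemma card_antidiagonalTuple_add_le {n d e : ℕ} (he : e < d) :
    (Finset.Nat.antidiagonalTuple (n + 1) (e + d)).card +
        (Finset.Nat.antidiagonalTuple (n + 1) e).card ≤
      d ^ n + (n + 1) * (Finset.Nat.antidiagonalTuple (n + 1) e).card := by
  set T := Finset.Nat.antidiagonalTuple (n + 1) (e + d) with hT
  set U := Finset.Nat.antidiagonalTuple (n + 1) e with hU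
  set T' := T.filter fun t => ∀ i, t i < d with hT'
  have hcover : T ⊆ T' ∪ Finset.univ.biUnion fun i => U.image fun t => t + Pi.single i d := by
    intro t ht
    by_cases hlt : ∀ i, t i < d
    · exact Finset.mem_union_left _ (Finset.mem_filter.2 ⟨ht, hlt⟩)
    · push Not at hlt
      obtain ⟨i, hi⟩ := hlt
      have hsub : t - Pi.single i d + Pi.single i d = t := by
        ext j
        rcases eq_or_ne j i with rfl | hj
        · simp [hi]
        · simp [hj]
      refine Finset.mem_union_right _ (Finset.mem_biUnion.2 ⟨i, Finset.mem_univ _,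
        Finset.mem_image.2 ⟨t - Pi.single i d, ?_, hsub⟩⟩)
      rw [hT, Finset.Nat.mem_antidiagonalTuple, ← hsub] at ht
      simp only [Pi.add_apply, Finset.sum_add_distrib, Finset.sum_pi_single', Finset.mem_univ,
        if_true] at ht
      rw [hU, Finset.Nat.mem_antidiagonalTuple]
      omega
  have h1 : T.card ≤ T'.card + (n + 1) * U.card := by
    refine (Finset.card_le_card hcover).trans ((Finset.card_union_le _ _).trans ?_)
    refine Nat.add_le_add_left (Finset.card_biUnion_le.trans ?_) _
    refine (Finset.sum_le_card_nsmul _ _ U.card fun i _ => Finset.card_image_le).trans ?_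
    simp
  have h2 : T'.card + U.card ≤ d ^ n := by
    have hdisj : Disjoint T' U := by
      rw [Finset.disjoint_left]
      intro t ht ht'
      rw [hT', Finset.mem_filter, hT, Finset.Nat.mem_antidiagonalTuple] at ht
      rw [hU, Finset.Nat.mem_antidiagonalTuple] at ht'
      omega
    rw [← Finset.card_union_of_disjoint hdisj]
    refine (Finset.card_le_card (Finset.union_subset ?_ ?_)).trans (card_filter_sum_mod_le n d e)
    · intro t ht
      rw [hT', Finset.mem_filter, hT, Finset.Nat.mem_antidiagonalTuple] at ht
      simp only [Finset.mem_filter, Fintype.mem_piFinset, Finset.mem_range]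
      exact ⟨ht.2, by rw [ht.1, Nat.add_mod_right, Nat.mod_eq_of_lt he]⟩
    · intro t ht
      rw [hU, Finset.Nat.mem_antidiagonalTuple] at ht
      simp only [Finset.mem_filter, Fintype.mem_piFinset, Finset.mem_range]
      refine ⟨fun i => lt_of_le_of_lt ?_ he, by rw [ht, Nat.mod_eq_of_lt he]⟩
      rw [← ht]
      exact Finset.single_le_sum (fun _ _ => Nat.zero_le _) (Finset.mem_univ i)
  omega

end Counting

section Espace

variable {K : Type*} [Field K] {n : ℕ}

lemma mem_Dfin {e : ℕ} {u : Fin (n + 1) → ℤ} :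
    u ∈ Dfin n e ↔ ∃ t : Fin (n + 1) → ℕ, ∑ i, t i = e ∧ (fun i => (t i : ℤ)) = u := by
  simp [Dfin, Finset.Nat.mem_antidiagonalTuple]

lemma sub_mem_Dv {v : Fin (n + 1) → ℤ} {e : ℕ} {t : Fin (n + 1) → ℕ}
    (h : (fun i => v i - (t i : ℤ)) ∈ Dv v e) : ∑ i, t i = e := by
  obtain ⟨w, hw, hwt⟩ := Finset.mem_image.1 h
  obtain ⟨t', ht', rfl⟩ := mem_Dfin.1 hw
  rw [← ht']
  refine Finset.sum_congr rfl fun i _ => ?_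
  have := congrFun hwt i
  simp only [Pi.sub_apply] at this
  omega

lemma coeffZ_natCast (F : MvPolynomial (Fin (n + 1)) K) (t : Fin (n + 1) →₀ ℕ) :
    coeffZ F (fun i => (t i : ℤ)) = coeff t F := by
  rw [coeffZ, if_pos fun i => Int.natCast_nonneg _]
  congr 1
  ext i
  simp

lemma sum_Dfin_coeffZ_mul {F : MvPolynomial (Fin (n + 1)) K} {d : ℕ} (hF : F.IsHomogeneous d)
    (h : (Fin (n + 1) → ℤ) → K) :
    ∑ t ∈ Dfin n d, coeffZ F t * h t = ∑ t ∈ F.support, coeff t F * h fun i => (t i : ℤ) := by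
  refine (Finset.sum_of_injOn (fun t i => (t i : ℤ)) ?_ ?_ ?_ ?_).symm
  · intro t _ t' _ htt'
    ext i
    simpa using congrFun htt' i
  · intro t ht
    refine mem_Dfin.2 ⟨t, ?_, rfl⟩
    rw [← Finsupp.degree_eq_sum, Finsupp.degree_eq_weight_one]
    exact hF (mem_support_iff.1 ht)
  · intro u hu hu'
    obtain ⟨t, -, rfl⟩ := mem_Dfin.1 hu
    have hcoeff := coeffZ_natCast F (Finsupp.equivFunOnFinite.symm t)
    simp only [Finsupp.equivFunOnFinite_symm_apply_apply] at hcoeff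
    rw [hcoeff, notMem_support_iff.1 fun ht => hu' ⟨_, ht, by simp⟩, zero_mul]
  · intro t _
    rw [coeffZ_natCast]

/-- The linear functional on polynomials sending `x ^ t` to the coefficient `G_{v - t}`. -/
def pairing (v : Fin (n + 1) → ℤ) (G : (Fin (n + 1) → ℤ) →₀ K) :
    MvPolynomial (Fin (n + 1)) K →ₗ[K] K :=
  (basisMonomials (Fin (n + 1)) K).constr K fun t => G fun i => v i - (t i : ℤ)

lemma pairing_monomial (v : Fin (n + 1) → ℤ) (G : (Fin (n + 1) → ℤ) →₀ K)
    (t : Fin (n + 1) →₀ ℕ) (c : K) :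
    pairing v G (monomial t c) = c * G fun i => v i - (t i : ℤ) := by
  have h : monomial t c = c • basisMonomials (Fin (n + 1)) K t := by
    simp [coe_basisMonomials, smul_monomial]
  rw [h, map_smul, pairing, Module.Basis.constr_basis, smul_eq_mul]

lemma X_mul_pderiv_eq_sum (F : MvPolynomial (Fin (n + 1)) K) (i : Fin (n + 1)) :
    X i * pderiv i F = ∑ t ∈ F.support, monomial t (coeff t F * (t i : K)) := by
  conv_lhs => rw [F.as_sum, map_sum, Finset.mul_sum]
  refine Finset.sum_congr rfl fun t _ => ?_
  rw [X_mul_pderiv_monomial, ← Nat.cast_smul_eq_nsmul K, smul_monomial, smul_eq_mul, mul_comm]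

lemma pairing_monomial_mul (v : Fin (n + 1) → ℤ) (G : (Fin (n + 1) → ℤ) →₀ K)
    (F : MvPolynomial (Fin (n + 1)) K) (i : Fin (n + 1)) (s : Fin (n + 1) →₀ ℕ) (c : K) :
    pairing v G (monomial s c * (X i * pderiv i F)) =
      c * ∑ t ∈ F.support, coeff t F * ((t i : K) * G fun j => v j - (s j : ℤ) - (t j : ℤ)) := by
  rw [X_mul_pderiv_eq_sum, Finset.mul_sum, map_sum, Finset.mul_sum]
  refine Finset.sum_congr rfl fun t _ => ?_
  rw [monomial_mul, pairing_monomial]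
  simp only [Finsupp.add_apply, Nat.cast_add, sub_sub]
  ring

lemma eqFun_apply {F : MvPolynomial (Fin (n + 1)) K} {d : ℕ} (hF : F.IsHomogeneous d) (m : ℕ)
    (v s : Fin (n + 1) → ℤ) (i : Fin (n + 1)) (G : (Fin (n + 1) → ℤ) →₀ K) :
    eqFun F d m v s i G = ((v i - s i : ℤ) : K) * mulCoeffZ F G (v - s) -
      ((m : K) + 1) *
        ∑ t ∈ F.support, coeff t F * ((t i : K) * G fun j => v j - s j - (t j : ℤ)) := by
  have h := sum_Dfin_coeffZ_mul hF fun t =>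
    (((v i - s i : ℤ) : K) - ((m : K) + 1) * ((t i : ℤ) : K)) * G (v - s - t)
  have h' : eqFun F d m v s i G = ∑ t ∈ Dfin n d, coeffZ F t *
      ((((v i - s i : ℤ) : K) - ((m : K) + 1) * ((t i : ℤ) : K)) * G (v - s - t)) := by
    simp only [eqFun, LinearMap.sum_apply, LinearMap.smul_apply, Finsupp.lapply_apply, smul_eq_mul]
    exact Finset.sum_congr rfl fun t _ => by ring
  rw [h', h, mulCoeffZ, Finset.mul_sum, Finset.mul_sum, ← Finset.sum_sub_distrib]
  refine Finset.sum_congr rfl fun t _ => ?_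
  rw [Int.cast_natCast]
  change coeff t F * ((_ - _) * G fun j => v j - s j - (t j : ℤ)) =
    _ * (coeff t F * G fun j => v j - s j - (t j : ℤ)) - _
  ring

lemma mem_Espace {F : MvPolynomial (Fin (n + 1)) K} {d m : ℕ} {v : Fin (n + 1) → ℤ} {ℓ : ℕ}
    {G : (Fin (n + 1) → ℤ) →₀ K} :
    G ∈ Espace F d m v ℓ ↔ (∀ u ∉ Dv v ℓ, G u = 0) ∧
      ∀ s ∈ Dfin n (ℓ - d), ∀ i, eqFun F d m v s i G = 0 := by
  simp [Espace, Finsupp.mem_supported', Submodule.mem_iInf]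

/-- If the coefficients of `F * G` on `D(v, ℓ - d)` vanish, then `G ∈ ℰ_{v,ℓ}` pairs to zero
with the ideal `I_F`. -/
lemma pairing_eq_zero_of_mem_partialIdeal {F : MvPolynomial (Fin (n + 1)) K} {d m : ℕ}
    (hF : F.IsHomogeneous d) (hm : (m : K) + 1 ≠ 0) {v : Fin (n + 1) → ℤ} {ℓ : ℕ}
    {G : (Fin (n + 1) → ℤ) →₀ K} (hG : G ∈ Espace F d m v ℓ)
    (hFG : ∀ s ∈ Dfin n (ℓ - d), mulCoeffZ F G (v - s) = 0)
    {p : MvPolynomial (Fin (n + 1)) K} (hp : p ∈ partialIdeal F) : pairing v G p = 0 := by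
  rw [mem_Espace] at hG
  obtain ⟨a, rfl⟩ := (Ideal.mem_span_range_iff_exists_fun).1 hp
  rw [map_sum]
  refine Finset.sum_eq_zero fun i _ => ?_
  rw [(a i).as_sum, Finset.sum_mul, map_sum]
  refine Finset.sum_eq_zero fun s _ => ?_
  rw [pairing_monomial_mul]
  by_cases hs : ∑ j, s j + d = ℓ
  · have hs' : (fun j => (s j : ℤ)) ∈ Dfin n (ℓ - d) := mem_Dfin.2 ⟨s, by omega, rfl⟩
    have h := hG.2 _ hs' i
    rw [eqFun_apply hF, hFG _ hs', mul_zero, zero_sub, neg_eq_zero, mul_eq_zero] at h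
    rw [h.resolve_left hm, mul_zero]
  · rw [Finset.sum_eq_zero, mul_zero]
    intro t ht
    rw [hG.1, mul_zero, mul_zero]
    intro hmem
    refine hs ?_
    have hdeg : ∑ j, t j = d := by
      rw [← Finsupp.degree_eq_sum, Finsupp.degree_eq_weight_one]
      exact hF (mem_support_iff.1 ht)
    have hsum := sub_mem_Dv (t := fun j => s j + t j) (by simpa [sub_sub] using hmem)
    rw [← hsum, Finset.sum_add_distrib, hdeg]

lemma eq_zero_of_mem_Espace {F : MvPolynomial (Fin (n + 1)) K} {d m : ℕ}
    (hF : F.IsHomogeneous d) (hm : (m : K) + 1 ≠ 0) {v : Fin (n + 1) → ℤ} {ℓ : ℕ}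
    {B : Finset (Fin (n + 1) → ℕ)} (hB : IsMonomialBasis F ℓ B)
    {G : (Fin (n + 1) → ℤ) →₀ K} (hG : G ∈ Espace F d m v ℓ)
    (hGB : ∀ β ∈ B, G (fun i => v i - (β i : ℤ)) = 0)
    (hFG : ∀ s ∈ Dfin n (ℓ - d), mulCoeffZ F G (v - s) = 0) : G = 0 := by
  ext u
  by_cases hu : u ∈ Dv v ℓ
  swap
  · exact (mem_Espace.1 hG).1 u hu
  obtain ⟨w, hw, rfl⟩ := Finset.mem_image.1 hu
  obtain ⟨t, ht, rfl⟩ := mem_Dfin.1 hw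
  set τ := Finsupp.equivFunOnFinite.symm t
  let q := (Ideal.Quotient.mkₐ K (partialIdeal F)).toLinearMap
  let b : B → MvPolynomial (Fin (n + 1)) K :=
    fun β => monomial (Finsupp.equivFunOnFinite.symm (β : Fin (n + 1) → ℕ)) 1
  have hmem : q (monomial τ 1) ∈ Submodule.map q (Submodule.span K (Set.range b)) := by
    rw [Submodule.map_span, ← Set.range_comp]
    refine hB.2.symm ▸ Submodule.mem_map_of_mem ?_
    refine isHomogeneous_monomial _ ?_
    rw [Finsupp.degree_eq_sum]
    exact ht
  obtain ⟨p, hp, hpq⟩ := hmem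
  have hker : Submodule.span K (Set.range b) ≤ LinearMap.ker (pairing v G) := by
    rw [Submodule.span_le]
    rintro _ ⟨β, rfl⟩
    simp [b, pairing_monomial, hGB β β.2]
  have hI : p - monomial τ 1 ∈ partialIdeal F := Ideal.Quotient.eq.1 hpq
  have h := pairing_eq_zero_of_mem_partialIdeal hF hm hG hFG hI
  rw [map_sub, LinearMap.mem_ker.1 (hker hp), zero_sub, neg_eq_zero, pairing_monomial,
    one_mul] at h
  exact h

/-- The map `G ↦ (G|_{B(v,ℓ)}, (FG)|_{D(v,e)})` in coordinates. -/
def restrictionMap (F : MvPolynomial (Fin (n + 1)) K) (v : Fin (n + 1) → ℤ)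
    (B : Finset (Fin (n + 1) → ℕ)) (e : ℕ) :
    ((Fin (n + 1) → ℤ) →₀ K) →ₗ[K] (B → K) × (Finset.Nat.antidiagonalTuple (n + 1) e → K) :=
  (LinearMap.pi fun β => Finsupp.lapply fun i => v i - (β.1 i : ℤ)).prod
    (LinearMap.pi fun s => ∑ t ∈ F.support,
      coeff t F • Finsupp.lapply fun i => v i - (s.1 i : ℤ) - (t i : ℤ))

lemma rank_Espace_le {F : MvPolynomial (Fin (n + 1)) K} {d m : ℕ}
    (hF : F.IsHomogeneous d) (hm : (m : K) + 1 ≠ 0) {v : Fin (n + 1) → ℤ} {ℓ : ℕ}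
    {B : Finset (Fin (n + 1) → ℕ)} (hB : IsMonomialBasis F ℓ B) :
    Module.rank K (Espace F d m v ℓ) ≤
      ((B.card + (Finset.Nat.antidiagonalTuple (n + 1) (ℓ - d)).card : ℕ) : Cardinal) := by
  have hinj : Function.Injective
      ((restrictionMap F v B (ℓ - d)).domRestrict (Espace F d m v ℓ)) := by
    refine (injective_iff_map_eq_zero _).2 fun G hG => ?_
    have hG' : restrictionMap F v B (ℓ - d) G.1 = 0 := hG
    refine Subtype.ext (eq_zero_of_mem_Espace hF hm hB G.2 (fun β hβ => ?_) fun s hs => ?_)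
    · simpa [restrictionMap] using congrFun (congrArg Prod.fst hG') ⟨β, hβ⟩
    · obtain ⟨t, ht, rfl⟩ := mem_Dfin.1 hs
      have h := congrFun (congrArg Prod.snd hG')
        ⟨t, Finset.Nat.mem_antidiagonalTuple.2 ht⟩
      simpa [restrictionMap, mulCoeffZ] using h
  refine (LinearMap.rank_le_of_injective _ hinj).trans ?_
  rw [← Module.finrank_eq_rank, Nat.cast_le]
  simp

lemma IsMonomialBasis.card_eq {F : MvPolynomial (Fin (n + 1)) K} {ℓ : ℕ}
    {B : Finset (Fin (n + 1) → ℕ)} (hB : IsMonomialBasis F ℓ B) : B.card = bdim F ℓ := by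
  rw [bdim, ← hB.2, finrank_span_eq_card hB.1, Fintype.card_coe]

end Espace

/-- Corollary 3.8: for `d ≤ ℓ < 2d`, `m + 1 ≠ 0` in `K`, and `v` of degree `dm + ℓ`, the
map `π : ℰ_{v,ℓ} → K[x^±]_{B(v,ℓ)} × K[x^±]_{D(v,ℓ-d)}`,
`G ↦ (G|_{B(v,ℓ)}, (FG)|_{D(v,ℓ-d)})`, is injective; consequently
`dim_K ℰ_{v,ℓ} ≤ b_ℓ + b_{ℓ-d}`, and if `F` is nondegenerate then
`dim_K ℰ_{v,ℓ} ≤ d^n`. -/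
theorem pi_injective_and_dim_le {K : Type*} [Field K] (n : ℕ) (hn : 1 ≤ n)
    (d : ℕ) (hd : 2 ≤ d) (hdK : (d : K) ≠ 0)
    (F : MvPolynomial (Fin (n + 1)) K) (hF : F.IsHomogeneous d)
    (ℓ : ℕ) (hℓ₁ : d ≤ ℓ) (hℓ₂ : ℓ < 2 * d)
    (m : ℕ) (hm : ((m : K) + 1) ≠ 0)
    (v : Fin (n + 1) → ℤ) (hv : (∑ i, v i) = ((d * m + ℓ : ℕ) : ℤ))
    (Bl : Finset (Fin (n + 1) → ℕ)) (hBl : Bl ⊆ Finset.Nat.antidiagonalTuple (n + 1) ℓ)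
    (hBlbasis : IsMonomialBasis F ℓ Bl) :
    (∀ G₁ ∈ Espace F d m v ℓ, ∀ G₂ ∈ Espace F d m v ℓ,
        (∀ β ∈ Bl, G₁ (fun i => v i - (β i : ℤ)) = G₂ (fun i => v i - (β i : ℤ))) →
        (∀ s ∈ Dfin n (ℓ - d), mulCoeffZ F G₁ (v - s) = mulCoeffZ F G₂ (v - s)) →
        G₁ = G₂)
    ∧ Module.rank K ↥(Espace F d m v ℓ) ≤ ((bdim F ℓ + bdim F (ℓ - d) : ℕ) : Cardinal)
    ∧ ((∀ x : Fin (n + 1) → AlgebraicClosure K,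
          (∀ i, MvPolynomial.aeval x (X i * pderiv i F) = 0) → x = 0) →
        Module.rank K ↥(Espace F d m v ℓ) ≤ ((d ^ n : ℕ) : Cardinal)) := by
  refine ⟨fun G₁ h₁ G₂ h₂ hB hFG => ?_, ?_, fun hnd => ?_⟩
  · rw [← sub_eq_zero]
    refine eq_zero_of_mem_Espace hF hm hBlbasis (Submodule.sub_mem _ h₁ h₂) (fun β hβ => ?_)
      fun s hs => ?_
    · rw [Finsupp.sub_apply, hB β hβ, sub_self]
    · rw [← sub_eq_zero.2 (hFG s hs), mulCoeffZ, mulCoeffZ, mulCoeffZ, ← Finset.sum_sub_distrib]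
      exact Finset.sum_congr rfl fun t _ => by rw [Finsupp.sub_apply, mul_sub]
  · rw [← hBlbasis.card_eq, bdim_of_lt hF (show ℓ - d < d by omega)]
    exact rank_Espace_le hF hm hBlbasis
  · refine (rank_Espace_le hF hm hBlbasis).trans (Nat.cast_le.2 ?_)
    have h₁ := bdim_add_le hF (show ℓ - d < d by omega) hnd
    have h₂ := card_antidiagonalTuple_add_le (n := n) (show ℓ - d < d by omega)
    rw [Nat.sub_add_cancel hℓ₁] at h₁ h₂
    rw [hBlbasis.card_eq]
    omega
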